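/- (Regularity of the modified test function.) Fix μ > 0, ħ > 0, a > 0, T ∈ ℝ and a smooth cut-off χ as below. For f, g ∈ C_c^∞(ℝ²) define g_Q(x) := g(x) e^{−(a²/2) Q₀(x,x)} and g̃(y) := g_Q(y) · ∫_{ℝ²} (Q₀(y,z) + ħω₀(y−z)) f(z) dz. Then for every y the integral in the definition of g̃ converges absolutely, and g̃ : ℝ² → ℂ is smooth and compactly supported. -/

import Mathlib

open MeasureTheory

noncomputable section

/-- The absolute value of the Minkowskian square: `σ(z) := |t² − s²|`. -/
def mink (z : ℝ × ℝ) : ℝ := |z.1 ^ 2 - z.2 ^ 2|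

/-- The real part of the massless Feynman propagator on two-dimensional Minkowski
spacetime at scale `μ`: `𝓗₀(z) := −(1/(4π)) log(σ(z)/(4μ²))` (junk value where `σ(z) = 0`). -/
def H0 (μ : ℝ) (z : ℝ × ℝ) : ℝ := -(1 / (4 * Real.pi)) * Real.log (mink z / (4 * μ ^ 2))

/-- The massless causal propagator `Δ₀(t,s) := −(1/2)(1_{t≥|s|} − 1_{−t≥|s|})`. -/
def Delta0 (z : ℝ × ℝ) : ℝ :=
  -(1 / 2) * ((if |z.2| ≤ z.1 then (1 : ℝ) else 0) - (if |z.2| ≤ -z.1 then (1 : ℝ) else 0))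

/-- The massless two-point function at scale `μ`: `ω₀(z) := 𝓗₀(z) + (i/2)Δ₀(z)`. -/
def omega0 (μ : ℝ) (z : ℝ × ℝ) : ℂ := (H0 μ z : ℂ) + (Complex.I / 2) * ((Delta0 z : ℝ) : ℂ)

/-- The covariance kernel `Q₀(z,z') = (1/4) ∫ χ(t̃)² 1_{t̃+|x−x̃| ≤ t} 1_{t̃+|x'−x̃| ≤ t'} dt̃ dx̃`
of the solution of the linear stochastic wave equation with noise cut-off `χ`. -/
def Q0 (χ : ℝ → ℝ) (z z' : ℝ × ℝ) : ℝ :=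
  (1 / 4) * ∫ w : ℝ × ℝ,
    χ w.1 ^ 2 * (if w.1 + |z.2 - w.2| ≤ z.1 then (1 : ℝ) else 0) *
      (if w.1 + |z'.2 - w.2| ≤ z'.1 then (1 : ℝ) else 0)

/-- Convolving a locally integrable kernel with a smooth compactly supported function gives a
convergent integral which depends smoothly on the point. -/
lemma integrable_and_contDiff_kernel {𝕜 : Type*} [RCLike 𝕜] {K φ : ℝ × ℝ → 𝕜}
    (hK : LocallyIntegrable K) (hφ : ContDiff ℝ (⊤ : ℕ∞) φ) (hφc : HasCompactSupport φ) :
    (∀ y, Integrable fun z => K (y - z) * φ z) ∧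
      ContDiff ℝ (⊤ : ℕ∞) fun y => ∫ z, K (y - z) * φ z := by
  constructor
  · intro y
    exact convolutionExistsAt_iff_integrable_swap.1
      (hφc.convolutionExists_right (ContinuousLinearMap.mul ℝ 𝕜) hK hφ.continuous y)
  · have h := hφc.contDiff_convolution_right (ContinuousLinearMap.mul ℝ 𝕜) hK hφ
    convert h using 1
    ext y
    rw [convolution_eq_swap]
    rfl

/-- The indicator function of the closed forward light cone. -/
def cone (u : ℝ × ℝ) : ℝ := if |u.2| ≤ u.1 then 1 else 0

lemma measurable_cone : Measurable cone := by
  refine Measurable.ite (measurableSet_le ?_ ?_) measurable_const measurable_const <;> fun_prop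

lemma cone_nonneg (u : ℝ × ℝ) : 0 ≤ cone u := by
  unfold cone; split_ifs <;> norm_num

lemma cone_le_one (u : ℝ × ℝ) : cone u ≤ 1 := by
  unfold cone; split_ifs <;> norm_num

lemma abs_cone_le_one (u : ℝ × ℝ) : |cone u| ≤ 1 := by
  rw [abs_of_nonneg (cone_nonneg u)]; exact cone_le_one u

lemma abs_le_of_cone_ne_zero {u : ℝ × ℝ} (h : cone u ≠ 0) : |u.2| ≤ u.1 := by
  by_contra hu
  exact h (if_neg hu)

lemma locallyIntegrable_of_bound_one {K : ℝ × ℝ → ℝ} (hK : Measurable K) (h : ∀ u, |K u| ≤ 1) :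
    LocallyIntegrable K :=
  (locallyIntegrable_const (1 : ℝ)).mono hK.aestronglyMeasurable
    (Filter.Eventually.of_forall fun u => by simpa using h u)

lemma locallyIntegrable_cone : LocallyIntegrable cone :=
  locallyIntegrable_of_bound_one measurable_cone abs_cone_le_one

lemma Q0_eq_cone (χ : ℝ → ℝ) (y z : ℝ × ℝ) :
    Q0 χ y z = (1 / 4) * ∫ w : ℝ × ℝ, χ w.1 ^ 2 * cone (y - w) * cone (z - w) := by
  simp only [Q0, cone, Prod.fst_sub, Prod.snd_sub, le_sub_iff_add_le']

lemma locallyIntegrable_log_snd :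
    LocallyIntegrable fun z : ℝ × ℝ => Real.log z.2 := by
  intro x
  refine ⟨Set.Icc (x.1 - 1) (x.1 + 1) ×ˢ Set.Icc (x.2 - 1) (x.2 + 1), prod_mem_nhds
    (Icc_mem_nhds (by linarith) (by linarith)) (Icc_mem_nhds (by linarith) (by linarith)), ?_⟩
  rw [IntegrableOn, Measure.volume_eq_prod, ← Measure.prod_restrict]
  have h : IntegrableOn Real.log (Set.Icc (x.2 - 1) (x.2 + 1)) :=
    (intervalIntegrable_iff_integrableOn_Icc_of_le (by linarith)).1
      intervalIntegral.intervalIntegrable_log'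
  exact Integrable.comp_snd h _

lemma locallyIntegrable_log_add :
    LocallyIntegrable fun z : ℝ × ℝ => Real.log (z.1 + z.2) := by
  have h := locallyIntegrable_map_homeomorph (Homeomorph.shearAddRight ℝ)
    (f := fun z : ℝ × ℝ => Real.log z.2) (μ := volume)
  have hm : Measure.map (Homeomorph.shearAddRight ℝ) (volume : Measure (ℝ × ℝ)) = volume :=
    (measurePreserving_prod_add (volume : Measure ℝ) (volume : Measure ℝ)).map_eq
  rw [hm] at h
  exact h.1 locallyIntegrable_log_snd

lemma locallyIntegrable_log_sub :
    LocallyIntegrable fun z : ℝ × ℝ => Real.log (z.1 - z.2) := by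
  have h := locallyIntegrable_map_homeomorph (Homeomorph.shearAddRight ℝ).symm
    (f := fun z : ℝ × ℝ => Real.log z.2) (μ := volume)
  have hm : Measure.map (Homeomorph.shearAddRight ℝ).symm (volume : Measure (ℝ × ℝ)) = volume :=
    (measurePreserving_prod_neg_add (volume : Measure ℝ) (volume : Measure ℝ)).map_eq
  rw [hm] at h
  refine (h.1 locallyIntegrable_log_snd).congr (Filter.Eventually.of_forall fun z => ?_)
  change Real.log (-z.1 + z.2) = _
  rw [← Real.log_neg_eq_log]
  ring_nf

lemma locallyIntegrable_norm {K : ℝ × ℝ → ℝ} (hK : LocallyIntegrable K) :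
    LocallyIntegrable fun z => ‖K z‖ :=
  hK.mono hK.aestronglyMeasurable.norm (Filter.Eventually.of_forall fun z => by simp)

lemma locallyIntegrable_log_mink : LocallyIntegrable fun z : ℝ × ℝ => Real.log (mink z) := by
  refine ((locallyIntegrable_norm locallyIntegrable_log_add).add
    (locallyIntegrable_norm locallyIntegrable_log_sub)).mono ?_
    (Filter.Eventually.of_forall fun z => ?_)
  · unfold mink
    exact (by fun_prop : Measurable _).aestronglyMeasurable
  · have h : mink z = |(z.1 + z.2) * (z.1 - z.2)| := by rw [mink]; ring_nf
    rw [h, Real.log_abs]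
    by_cases h1 : z.1 + z.2 = 0
    · simp [h1]
    by_cases h2 : z.1 - z.2 = 0
    · simp [h2]
    rw [Real.log_mul h1 h2]
    exact (norm_add_le _ _).trans (le_abs_self _)

lemma locallyIntegrable_H0 (μ : ℝ) : LocallyIntegrable (H0 μ) := by
  have h : LocallyIntegrable fun z : ℝ × ℝ =>
      ‖(1 / (4 * Real.pi)) • Real.log (mink z)‖ +
        ‖(1 / (4 * Real.pi)) * Real.log (4 * μ ^ 2)‖ :=
    (locallyIntegrable_norm (locallyIntegrable_log_mink.smul (1 / (4 * Real.pi)))).add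
      (locallyIntegrable_const _)
  refine h.mono ?_ (Filter.Eventually.of_forall fun z => ?_)
  · unfold H0 mink
    exact (by fun_prop : Measurable _).aestronglyMeasurable
  · rw [Real.norm_of_nonneg (by positivity : 0 ≤ ‖(1 / (4 * Real.pi)) • Real.log (mink z)‖ +
        ‖(1 / (4 * Real.pi)) * Real.log (4 * μ ^ 2)‖), H0]
    by_cases h1 : mink z = 0
    · simp only [h1, zero_div, Real.log_zero, mul_zero, norm_zero]
      positivity
    by_cases h2 : 4 * μ ^ 2 = 0
    · simp only [h2, div_zero, Real.log_zero, mul_zero, norm_zero]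
      positivity
    rw [Real.log_div h1 h2, smul_eq_mul, neg_mul, norm_neg, mul_sub]
    exact norm_sub_le _ _

lemma locallyIntegrable_Delta0 : LocallyIntegrable Delta0 := by
  refine locallyIntegrable_of_bound_one ?_ fun u => ?_
  · unfold Delta0
    refine measurable_const.mul (Measurable.sub ?_ ?_) <;>
      refine Measurable.ite (measurableSet_le ?_ ?_) measurable_const measurable_const <;> fun_prop
  · unfold Delta0
    split_ifs <;> norm_num [abs_le]

lemma locallyIntegrable_omega0 (μ : ℝ) : LocallyIntegrable (omega0 μ) := by
  have hof : ∀ {K : ℝ × ℝ → ℝ}, LocallyIntegrable K → LocallyIntegrable fun z => (K z : ℂ) := by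
    intro K hK x
    obtain ⟨U, hU, h⟩ := hK x
    exact ⟨U, hU, Integrable.ofReal h⟩
  exact (hof (locallyIntegrable_H0 μ)).add
    ((hof locallyIntegrable_Delta0).smul (Complex.I / 2))

section Cutoff

variable {χ : ℝ → ℝ} {T : ℝ}

/-- Integrability holds because the cut-off vanishes on the past light cone of `y` outside a bounded
set. -/
lemma integrable_sq_mul_cone (hχ : Continuous χ) (hχa : ∀ t, t < T → χ t = 0) (y : ℝ × ℝ) :
    Integrable fun w : ℝ × ℝ => χ w.1 ^ 2 * cone (y - w) := by
  have hc : Continuous fun w : ℝ × ℝ => χ w.1 ^ 2 := by fun_prop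
  have hl : LocallyIntegrable fun w : ℝ × ℝ => χ w.1 ^ 2 * cone (y - w) := by
    refine hc.locallyIntegrable.mono (hc.measurable.mul
      (measurable_cone.comp (measurable_const.sub measurable_id))).aestronglyMeasurable
      (Filter.Eventually.of_forall fun w => ?_)
    rw [norm_mul]
    exact mul_le_of_le_one_right (norm_nonneg _) (abs_cone_le_one _)
  refine (integrableOn_iff_integrable_of_support_subset fun w hw => ?_).1
    (hl.integrableOn_isCompact ((isCompact_Icc (a := T) (b := y.1)).prod
      (isCompact_Icc (a := y.2 - (y.1 - T)) (b := y.2 + (y.1 - T)))))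
  have hT : T ≤ w.1 := by
    by_contra! h
    exact hw (by simp [hχa _ h])
  have h := abs_le.1 (abs_le_of_cone_ne_zero (right_ne_zero_of_mul hw))
  simp only [Prod.fst_sub, Prod.snd_sub] at h
  simp only [Set.mem_prod, Set.mem_Icc]
  refine ⟨⟨hT, ?_⟩, ?_, ?_⟩ <;> linarith [h.1, h.2]

lemma integrable_sq_mul_cone_mul_cone (hχ : Continuous χ) (hχa : ∀ t, t < T → χ t = 0)
    {f : ℝ × ℝ → ℝ} (hf : Integrable f) (y : ℝ × ℝ) :
    Integrable (Function.uncurry fun w z : ℝ × ℝ =>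
      χ w.1 ^ 2 * cone (y - w) * cone (z - w) * f z) (volume.prod volume) := by
  have h := (integrable_sq_mul_cone hχ hχa y).mul_prod hf
  have hm : Measurable fun p : (ℝ × ℝ) × (ℝ × ℝ) => cone (p.2 - p.1) :=
    measurable_cone.comp (measurable_snd.sub measurable_fst)
  refine (h.bdd_mul (c := 1) hm.aestronglyMeasurable
    (Filter.Eventually.of_forall fun p => abs_cone_le_one _)).congr
    (Filter.Eventually.of_forall fun p => ?_)
  simp only [Function.uncurry]
  ring

/-- The covariance kernel applied to a test function converges and is smooth. -/
lemma integrable_and_contDiff_Q0 (hχ : ContDiff ℝ (⊤ : ℕ∞) χ) (hχa : ∀ t, t < T → χ t = 0)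
    {f : ℝ × ℝ → ℝ} (hf : ContDiff ℝ (⊤ : ℕ∞) f) (hfc : HasCompactSupport f) :
    (∀ y, Integrable fun z => Q0 χ y z * f z) ∧
      ContDiff ℝ (⊤ : ℕ∞) fun y => ∫ z, Q0 χ y z * f z := by
  have hfi : Integrable f := hf.continuous.integrable_of_hasCompactSupport hfc
  have hQ : ∀ y z, Q0 χ y z * f z =
      (1 / 4) * ∫ w : ℝ × ℝ, χ w.1 ^ 2 * cone (y - w) * cone (z - w) * f z := by
    intro y z
    rw [Q0_eq_cone, integral_mul_const, mul_assoc]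
  have hG := integrable_sq_mul_cone_mul_cone hχ.continuous hχa hfi
  constructor
  · intro y
    simp only [hQ]
    exact (hG y).integral_prod_right.const_mul _
  have hneg : LocallyIntegrable fun u : ℝ × ℝ => cone (-u) :=
    locallyIntegrable_of_bound_one (measurable_cone.comp measurable_neg) fun u => abs_cone_le_one _
  have hh : ContDiff ℝ (⊤ : ℕ∞) fun w : ℝ × ℝ => ∫ z, cone (z - w) * f z := by
    simpa only [neg_sub] using (integrable_and_contDiff_kernel hneg hf hfc).2
  have hk : ContDiff ℝ (⊤ : ℕ∞) fun w : ℝ × ℝ => χ w.1 ^ 2 * ∫ z, cone (z - w) * f z :=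
    ((hχ.comp contDiff_fst).pow 2).mul hh
  have hkc : HasCompactSupport fun w : ℝ × ℝ => χ w.1 ^ 2 * ∫ z, cone (z - w) * f z := by
    obtain ⟨R, hR⟩ := hfc.isCompact.isBounded.subset_closedBall (0 : ℝ × ℝ)
    refine HasCompactSupport.intro ((isCompact_Icc (a := T) (b := R)).prod
      (isCompact_Icc (a := -(2 * R - T)) (b := 2 * R - T))) fun w hw => ?_
    by_contra hne
    apply hw
    have hT : T ≤ w.1 := by
      by_contra! h
      exact hne (by simp [hχa _ h])
    obtain ⟨z, hz⟩ : ∃ z, cone (z - w) * f z ≠ 0 := by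
      by_contra! h
      exact hne (by simp [h])
    have hc := abs_le.1 (abs_le_of_cone_ne_zero (left_ne_zero_of_mul hz))
    simp only [Prod.fst_sub, Prod.snd_sub] at hc
    have hzR : ‖z‖ ≤ R := by
      simpa using hR (subset_tsupport f (right_ne_zero_of_mul hz))
    have h1 := abs_le.1 ((norm_fst_le z).trans hzR)
    have h2 := abs_le.1 ((norm_snd_le z).trans hzR)
    simp only [Set.mem_prod, Set.mem_Icc]
    refine ⟨⟨hT, ?_⟩, ?_, ?_⟩ <;> linarith [hc.1, hc.2, h1.1, h1.2, h2.1, h2.2]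
  have hF := (integrable_and_contDiff_kernel locallyIntegrable_cone hk hkc).2
  have hswap : ∀ y, ∫ z, Q0 χ y z * f z =
      (1 / 4) * ∫ w, cone (y - w) * (χ w.1 ^ 2 * ∫ z, cone (z - w) * f z) := by
    intro y
    simp only [hQ, integral_const_mul]
    rw [← integral_integral_swap (hG y)]
    simp only [← integral_const_mul, mul_left_comm (cone (y - _)), mul_assoc]
  simp only [hswap]
  exact contDiff_const.mul hF

lemma integral_cone_snd (t x s : ℝ) :
    ∫ r : ℝ, cone (t - s, x - r) = max (2 * (t - s)) 0 := by
  have h : (fun r : ℝ => cone (t - s, x - r)) =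
      (Metric.closedBall x (t - s)).indicator fun _ => (1 : ℝ) := by
    ext r
    simp only [cone, Set.indicator, Metric.mem_closedBall, Real.dist_eq, abs_sub_comm r x]
  rw [h, integral_indicator_const _ measurableSet_closedBall, Measure.real, Real.volume_closedBall,
    ENNReal.toReal_ofReal', smul_eq_mul, mul_one]

lemma Q0_self_eq (hχ : Continuous χ) (hχa : ∀ t, t < T → χ t = 0) (y : ℝ × ℝ) :
    Q0 χ y y = (1 / 2) * (y.1 * (∫ s in (T - 1)..y.1, χ s ^ 2) -
      ∫ s in (T - 1)..y.1, χ s ^ 2 * s) := by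
  have hsq : ∀ u, cone u * cone u = cone u := fun u => by unfold cone; split_ifs <;> norm_num
  have hint := integrable_sq_mul_cone hχ hχa y
  have h1 : Q0 χ y y = (1 / 4) * ∫ s : ℝ, χ s ^ 2 * max (2 * (y.1 - s)) 0 := by
    simp only [Q0_eq_cone, mul_assoc, hsq]
    rw [Measure.volume_eq_prod] at hint ⊢
    rw [integral_prod _ hint]
    simp only [integral_const_mul, ← integral_cone_snd y.1 y.2]
    rfl
  have h2 : ∫ s : ℝ, χ s ^ 2 * max (2 * (y.1 - s)) 0 =
      ∫ s in (T - 1)..y.1, χ s ^ 2 * (2 * (y.1 - s)) := by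
    rcases le_total (T - 1) y.1 with h | h
    · rw [← intervalIntegral.integral_eq_integral_of_support_subset (a := T - 1) (b := y.1)]
      · refine intervalIntegral.integral_congr fun s hs => ?_
        rw [Set.uIcc_of_le h] at hs
        rw [max_eq_left (by linarith [hs.2])]
      · intro s hs
        refine ⟨?_, ?_⟩ <;> by_contra! hlt
        · exact hs (by simp [hχa s (by linarith)])
        · exact hs (by simp only [max_eq_right (by linarith : 2 * (y.1 - s) ≤ 0), mul_zero])
    · rw [intervalIntegral.integral_congr (g := fun _ => (0 : ℝ)), intervalIntegral.integral_zero]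
      · refine integral_eq_zero_of_ae (Filter.Eventually.of_forall fun s => ?_)
        rcases lt_or_ge s T with hs | hs
        · simp [hχa s hs]
        · simp only [max_eq_right (by linarith : 2 * (y.1 - s) ≤ 0), mul_zero, Pi.zero_apply]
      · intro s hs
        rw [Set.uIcc_of_ge h] at hs
        simp [hχa s (by linarith [hs.2])]
  have hc : Continuous fun s => χ s ^ 2 := by fun_prop
  have h3 : (fun s => χ s ^ 2 * (2 * (y.1 - s))) =
      fun s => 2 * (y.1 * χ s ^ 2 - χ s ^ 2 * s) := by ext s; ring
  rw [h1, h2, h3, intervalIntegral.integral_const_mul, intervalIntegral.integral_sub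
    (Continuous.intervalIntegrable (by fun_prop) _ _)
    (Continuous.intervalIntegrable (by fun_prop) _ _), intervalIntegral.integral_const_mul]
  ring

lemma contDiff_primitive {u : ℝ → ℝ} (hu : ContDiff ℝ (⊤ : ℕ∞) u) (c : ℝ) :
    ContDiff ℝ (⊤ : ℕ∞) fun t => ∫ s in c..t, u s := by
  have hd := fun t => intervalIntegral.integral_hasDerivAt_right
    (hu.continuous.intervalIntegrable c t) (hu.continuous.stronglyMeasurableAtFilter _ _)
    hu.continuous.continuousAt
  rw [contDiff_infty_iff_deriv]
  refine ⟨fun t => (hd t).differentiableAt, ?_⟩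
  rwa [funext fun t => (hd t).deriv]

lemma contDiff_Q0_self (hχ : ContDiff ℝ (⊤ : ℕ∞) χ) (hχa : ∀ t, t < T → χ t = 0) :
    ContDiff ℝ (⊤ : ℕ∞) fun y : ℝ × ℝ => Q0 χ y y := by
  simp only [Q0_self_eq hχ.continuous hχa]
  have h1 := (contDiff_primitive (hχ.pow 2) (T - 1)).comp (contDiff_fst (E := ℝ) (F := ℝ))
  have h2 := (contDiff_primitive ((hχ.pow 2).mul contDiff_id) (T - 1)).comp
    (contDiff_fst (E := ℝ) (F := ℝ))
  exact contDiff_const.mul ((contDiff_fst.mul h1).sub h2)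

end Cutoff

/-- **Regularity of the modified test function.**
For `f, g ∈ C_c^∞(ℝ²)`, set `g_Q(x) := g(x) e^{−(a²/2) Q₀(x,x)}` and
`g̃(y) := g_Q(y) ∫ (Q₀(y,z) + hbar·ω₀(y−z)) f(z) dz`.  Then the integral defining `g̃`
converges absolutely for every `y`, and `g̃ : ℝ² → ℂ` is smooth and compactly supported. -/
theorem modified_test_function_regular (μ hbar a T : ℝ)
    (hμ : 0 < μ) (hhbar : 0 < hbar) (ha : 0 < a)
    (χ : ℝ → ℝ) (hχ : ContDiff ℝ (⊤ : ℕ∞) χ) (hχ0 : ∀ t, 0 ≤ χ t)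
    (hχa : ∀ t, t < T → χ t = 0) (hχb : ∀ t, T + 1 ≤ t → χ t = 1)
    (f g : ℝ × ℝ → ℝ) (hf : ContDiff ℝ (⊤ : ℕ∞) f) (hfc : HasCompactSupport f)
    (hg : ContDiff ℝ (⊤ : ℕ∞) g) (hgc : HasCompactSupport g) :
    (∀ y : ℝ × ℝ, Integrable (fun z : ℝ × ℝ =>
        (((Q0 χ y z : ℝ) : ℂ) + (hbar : ℂ) * omega0 μ (y - z)) * ((f z : ℝ) : ℂ))) ∧
    ContDiff ℝ (⊤ : ℕ∞) (fun y : ℝ × ℝ =>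
      ((g y * Real.exp (-(a ^ 2 / 2) * Q0 χ y y) : ℝ) : ℂ) *
        ∫ z : ℝ × ℝ, (((Q0 χ y z : ℝ) : ℂ) + (hbar : ℂ) * omega0 μ (y - z)) * ((f z : ℝ) : ℂ)) ∧
    HasCompactSupport (fun y : ℝ × ℝ =>
      ((g y * Real.exp (-(a ^ 2 / 2) * Q0 χ y y) : ℝ) : ℂ) *
        ∫ z : ℝ × ℝ, (((Q0 χ y z : ℝ) : ℂ) + (hbar : ℂ) * omega0 μ (y - z)) * ((f z : ℝ) : ℂ)) := by
  obtain ⟨hQi, hQs⟩ := integrable_and_contDiff_Q0 hχ hχa hf hfc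
  have hfC : ContDiff ℝ (⊤ : ℕ∞) fun z => ((f z : ℝ) : ℂ) := Complex.ofRealCLM.contDiff.comp hf
  obtain ⟨hωi, hωs⟩ := integrable_and_contDiff_kernel (locallyIntegrable_omega0 μ) hfC
    (hfc.comp_left Complex.ofReal_zero)
  have hsplit : ∀ y z : ℝ × ℝ,
      (((Q0 χ y z : ℝ) : ℂ) + (hbar : ℂ) * omega0 μ (y - z)) * ((f z : ℝ) : ℂ) =
        ((Q0 χ y z * f z : ℝ) : ℂ) + (hbar : ℂ) * (omega0 μ (y - z) * ((f z : ℝ) : ℂ)) := by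
    intro y z
    push_cast
    ring
  have hQC : ∀ y, Integrable fun z => ((Q0 χ y z * f z : ℝ) : ℂ) := fun y => (hQi y).ofReal
  simp only [hsplit]
  refine ⟨fun y => (hQC y).add ((hωi y).const_mul _), ?_, ?_⟩
  · have hI : ∀ y, ∫ z, (((Q0 χ y z * f z : ℝ) : ℂ) +
        (hbar : ℂ) * (omega0 μ (y - z) * ((f z : ℝ) : ℂ))) =
        ((∫ z, Q0 χ y z * f z : ℝ) : ℂ) +
          (hbar : ℂ) * ∫ z, omega0 μ (y - z) * ((f z : ℝ) : ℂ) := by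
      intro y
      rw [integral_add (hQC y) ((hωi y).const_mul _), integral_const_mul,
        integral_complex_ofReal]
    simp only [hI]
    have hgQ : ContDiff ℝ (⊤ : ℕ∞) fun y => g y * Real.exp (-(a ^ 2 / 2) * Q0 χ y y) :=
      hg.mul (contDiff_const.mul (contDiff_Q0_self hχ hχa)).exp
    exact (Complex.ofRealCLM.contDiff.comp hgQ).mul
      ((Complex.ofRealCLM.contDiff.comp hQs).add (contDiff_const.mul hωs))
  · exact HasCompactSupport.mul_right
      ((HasCompactSupport.mul_right hgc).comp_left Complex.ofReal_zero)
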